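/- arXiv:2111.01614 — 4 statements merged into one kernel-verified Lean document; each statement's English description precedes it below -/
import Mathlib

section
/- Let A : ℝ → Matrix (Fin 3) (Fin 3) ℝ, w : ℝ → Matrix (Fin 3) (Fin 1) ℝ, v : ℝ → Matrix (Fin 1) (Fin 3) ℝ and a : ℝ → Matrix (Fin 1) (Fin 1) ℝ be paths such that A, w and a are continuous at 0, a(0) = 1, v(0) = 0, and v is differentiable at 0 with derivative v' (HasDerivAt v v' 0). Then, as t → 0 from the right, the rescaled matrices fromBlocks (A t) (t • w t) (t⁻¹ • v t) (a t) converge to the half-pipe holonomy matrix fromBlocks (A 0) 0 v' 1. That is, Tendsto (fun t => fromBlocks (A t) (t • w t) (t⁻¹ • v t) (a t)) (𝓝[>] 0) (𝓝 (fromBlocks (A 0) 0 v' 1)). -/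
open Filter Matrix

attribute [local instance] Matrix.normedAddCommGroup Matrix.normedSpace

theorem tendsto_fromBlocks {X l m n o R : Type*} [TopologicalSpace R] {F : Filter X}
    {A : X → Matrix n l R} {B : X → Matrix n m R} {C : X → Matrix o l R} {D : X → Matrix o m R}
    {A₀ : Matrix n l R} {B₀ : Matrix n m R} {C₀ : Matrix o l R} {D₀ : Matrix o m R}
    (hA : Tendsto A F (nhds A₀)) (hB : Tendsto B F (nhds B₀))
    (hC : Tendsto C F (nhds C₀)) (hD : Tendsto D F (nhds D₀)) :
    Tendsto (fun x => Matrix.fromBlocks (A x) (B x) (C x) (D x)) F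
      (nhds (Matrix.fromBlocks A₀ B₀ C₀ D₀)) := by
  have h : Continuous fun p : Matrix n l R × Matrix n m R × Matrix o l R × Matrix o m R =>
      Matrix.fromBlocks p.1 p.2.1 p.2.2.1 p.2.2.2 :=
    Continuous.matrix_fromBlocks (by fun_prop) (by fun_prop) (by fun_prop) (by fun_prop)
  exact (h.tendsto (A₀, B₀, C₀, D₀)).comp
    (hA.prodMk_nhds (hB.prodMk_nhds (hC.prodMk_nhds hD)))

/-- As `t → 0⁺`, the rescaled holonomy matrices
`fromBlocks (A t) (t • w t) (t⁻¹ • v t) (a t)` converge to the half-pipe holonomy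
`fromBlocks (A 0) 0 v' 1`, recording the first-order deformation direction `v'`. -/
theorem halfpipe_holonomy_limit
    (A : ℝ → Matrix (Fin 3) (Fin 3) ℝ) (w : ℝ → Matrix (Fin 3) (Fin 1) ℝ)
    (v : ℝ → Matrix (Fin 1) (Fin 3) ℝ) (a : ℝ → Matrix (Fin 1) (Fin 1) ℝ)
    (v' : Matrix (Fin 1) (Fin 3) ℝ)
    (hA : ContinuousAt A 0) (hw : ContinuousAt w 0) (ha : ContinuousAt a 0)
    (ha0 : a 0 = 1) (hv0 : v 0 = 0) (hv : HasDerivAt v v' 0) :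
    Tendsto (fun t : ℝ => Matrix.fromBlocks (A t) (t • w t) (t⁻¹ • v t) (a t))
      (nhdsWithin 0 (Set.Ioi 0))
      (nhds (Matrix.fromBlocks (A 0) 0 v' 1)) := by
  have hC : Tendsto (fun t : ℝ => t⁻¹ • v t) (nhdsWithin 0 (Set.Ioi 0)) (nhds v') := by
    have h := hv.tendsto_slope_zero_right
    simp only [zero_add, hv0, sub_zero] at h
    exact h
  have hB : Tendsto (fun t : ℝ => t • w t) (nhds 0) (nhds 0) := by
    simpa using tendsto_id.smul hw.tendsto
  exact tendsto_fromBlocks (hA.tendsto.mono_left nhdsWithin_le_nhds)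
    (hB.mono_left nhdsWithin_le_nhds) hC
    (ha0 ▸ ha.tendsto.mono_left nhdsWithin_le_nhds)
end

section
/- A locally injective holomorphic map with identically vanishing Schwarzian derivative is the restriction of a Möbius transformation: let U ⊆ ℂ be open and preconnected, and let f : ℂ → ℂ be differentiable (holomorphic) on U with deriv f z ≠ 0 for all z ∈ U. If S(f)(z) = 0 for all z ∈ U, where S is the Schwarzian derivative, then there exist a b c d : ℂ with a*d − b*c ≠ 0 such that for all z ∈ U, c*z + d ≠ 0 and f z = (a*z + b)/(c*z + d). -/
/-- The Schwarzian derivative of `f : ℂ → ℂ` at `z`: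
`S(f)(z) = (f''/f')'(z) − (1/2)((f''/f')(z))²`. -/
noncomputable def schwarzian (f : ℂ → ℂ) (z : ℂ) : ℂ :=
  deriv (fun w => deriv (deriv f) w / deriv f w) z
    - (1/2) * (deriv (deriv f) z / deriv f z)^2

/-- A function with vanishing derivative (in the `HasDerivAt` sense) on an open preconnected set is
constant there. -/
theorem exists_eq_const_of_hasDerivAt_zero {U : Set ℂ} (hU : IsOpen U) (hUc : IsPreconnected U)
    {g : ℂ → ℂ} (hg : ∀ z ∈ U, HasDerivAt g 0 z) : ∃ k, ∀ z ∈ U, g z = k :=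
  hU.exists_is_const_of_deriv_eq_zero hUc
    (fun z hz => (hg z hz).differentiableAt.differentiableWithinAt) fun z hz => (hg z hz).deriv

/-- A locally injective holomorphic map on an open preconnected set whose Schwarzian
derivative vanishes identically is the restriction of a Möbius transformation. -/
theorem schwarzian_eq_zero_iff_mobius (U : Set ℂ) (hU : IsOpen U) (hUc : IsPreconnected U)
    (f : ℂ → ℂ) (hf : DifferentiableOn ℂ f U)
    (hf' : ∀ z ∈ U, deriv f z ≠ 0)
    (hS : ∀ z ∈ U, schwarzian f z = 0) :
    ∃ a b c d : ℂ, a * d - b * c ≠ 0 ∧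
      ∀ z ∈ U, c * z + d ≠ 0 ∧ f z = (a * z + b) / (c * z + d) := by
  rcases U.eq_empty_or_nonempty with rfl | ⟨z₀, hz₀⟩
  · exact ⟨1, 0, 0, 1, by norm_num, by simp⟩
  have hf₁ : DifferentiableOn ℂ (deriv f) U := hf.deriv hU
  have hf₂ : DifferentiableOn ℂ (deriv (deriv f)) U := hf₁.deriv hU
  set p : ℂ → ℂ := fun w => deriv (deriv f) w / deriv f w
  have hd : ∀ z ∈ U, HasDerivAt f (deriv f z) z := fun z hz =>
    (hf.differentiableAt (hU.mem_nhds hz)).hasDerivAt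
  have hd₁ : ∀ z ∈ U, HasDerivAt (deriv f) (p z * deriv f z) z := fun z hz => by
    have h := (hf₁.differentiableAt (hU.mem_nhds hz)).hasDerivAt
    rwa [← div_mul_cancel₀ (deriv (deriv f) z) (hf' z hz)] at h
  have hp : ∀ z ∈ U, HasDerivAt p (p z ^ 2 / 2) z := fun z hz => by
    have h := ((hf₂.div hf₁ hf').differentiableAt (hU.mem_nhds hz)).hasDerivAt
    have hs : deriv p z - (1 / 2) * p z ^ 2 = 0 := hS z hz
    have he : deriv p z = p z ^ 2 / 2 := by linear_combination hs
    rw [← he]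
    exact h
  clear_value p
  -- The quotient of p ^ 2 by the derivative of f is a first integral.
  obtain ⟨K, hK⟩ : ∃ K, ∀ z ∈ U, p z ^ 2 / deriv f z = K := by
    refine exists_eq_const_of_hasDerivAt_zero hU hUc fun z hz => ?_
    have hne := hf' z hz
    refine (((hp z hz).pow 2).div (hd₁ z hz) hne).congr_deriv ?_
    simp only [Pi.pow_apply]
    field_simp
    ring
  by_cases hK0 : K = 0
  · have hp0 : ∀ z ∈ U, p z = 0 := fun z hz => by
      simpa [hf' z hz, hK0] using hK z hz
    obtain ⟨a, ha⟩ : ∃ a, ∀ z ∈ U, deriv f z = a :=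
      exists_eq_const_of_hasDerivAt_zero hU hUc fun z hz => by
        simpa [hp0 z hz] using hd₁ z hz
    obtain ⟨b, hb⟩ : ∃ b, ∀ z ∈ U, f z - a * z = b :=
      exists_eq_const_of_hasDerivAt_zero hU hUc fun z hz => by
        exact ((hd z hz).sub ((hasDerivAt_id z).const_mul a)).congr_deriv (by simp [ha z hz])
    refine ⟨a, b, 0, 1, ?_, fun z hz => ⟨by simp, ?_⟩⟩
    · simpa [ha z₀ hz₀] using hf' z₀ hz₀
    · linear_combination hb z hz
  · have hp0 : ∀ z ∈ U, p z ≠ 0 := fun z hz h => hK0 (by rw [← hK z hz, h]; simp)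
    obtain ⟨d, hd'⟩ : ∃ d, ∀ z ∈ U, (p z)⁻¹ + z / 2 = d := by
      refine exists_eq_const_of_hasDerivAt_zero hU hUc fun z hz => ?_
      have hne := hp0 z hz
      refine (((hp z hz).inv hne).add ((hasDerivAt_id z).div_const 2)).congr_deriv ?_
      field_simp
      ring
    obtain ⟨e, he⟩ : ∃ e, ∀ z ∈ U, f z - 2 / K * p z = e := by
      refine exists_eq_const_of_hasDerivAt_zero hU hUc fun z hz => ?_
      have hfK : deriv f z = p z ^ 2 / K := by
        rw [eq_div_iff hK0, ← hK z hz, mul_div_cancel₀ _ (hf' z hz)]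
      refine ((hd z hz).sub ((hp z hz).const_mul (2 / K))).congr_deriv ?_
      rw [hfK]
      ring
    refine ⟨-e / 2, e * d + 2 / K, -1 / 2, d, ?_, fun z hz => ?_⟩
    · have h : -e / 2 * d - (e * d + 2 / K) * (-1 / 2) = K⁻¹ := by ring
      rw [h]
      exact inv_ne_zero hK0
    · have hden : -1 / 2 * z + d = (p z)⁻¹ := by linear_combination -hd' z hz
      have hne := hp0 z hz
      rw [hden]
      refine ⟨inv_ne_zero hne, ?_⟩
      rw [div_inv_eq_mul]
      have hm : (p z)⁻¹ * p z = 1 := inv_mul_cancel₀ hne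
      linear_combination he z hz - e * hm - e * p z * hden
end

section
/- Let λ ∈ (−1, 1) be a principal curvature of a minimal surface in an almost-Fuchsian manifold. Then for every r : ℝ, one has Real.cosh r + λ * Real.sinh r > 0, and the quantity (Real.sinh r + λ * Real.cosh r) / (Real.cosh r + λ * Real.sinh r) lies in the open interval (−1, 1). (Hence every equidistant surface S_r at oriented distance r from the minimal surface is a smooth embedded surface whose principal curvatures again lie in (−1, 1).) -/
/-- If `λ ∈ (−1,1)` is a principal curvature of a minimal surface in an almost-Fuchsian
manifold, then for every `r` the equidistant surface `S_r` is smooth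
(`cosh r + λ sinh r > 0`) and its principal curvature
`(sinh r + λ cosh r)/(cosh r + λ sinh r)` again lies in `(−1,1)`. -/
theorem equidistant_principal_curvature (lam : ℝ) (h₁ : -1 < lam) (h₂ : lam < 1) (r : ℝ) :
    Real.cosh r + lam * Real.sinh r > 0 ∧
    -1 < (Real.sinh r + lam * Real.cosh r) / (Real.cosh r + lam * Real.sinh r) ∧
    (Real.sinh r + lam * Real.cosh r) / (Real.cosh r + lam * Real.sinh r) < 1 := by
  have hp : 0 < (1 + lam) * Real.exp r := mul_pos (by linarith) (Real.exp_pos r)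
  have hm : 0 < (1 - lam) * Real.exp (-r) := mul_pos (by linarith) (Real.exp_pos (-r))
  rw [← Real.cosh_add_sinh] at hp
  rw [← Real.cosh_sub_sinh] at hm
  have hpos : 0 < Real.cosh r + lam * Real.sinh r := by linarith
  refine ⟨hpos, ?_, ?_⟩
  · rw [lt_div_iff₀ hpos]
    linarith
  · rw [div_lt_one hpos]
    linarith
end

section
/- First fundamental form at infinity as a limit of equidistant first fundamental forms: let V be a real vector space (AddCommGroup with Module ℝ), g : V →ₗ[ℝ] V →ₗ[ℝ] ℝ a bilinear form, and B : V →ₗ[ℝ] V a linear endomorphism which is self-adjoint with respect to g, i.e. g (B x) y = g x (B y) for all x y. For r : ℝ define I_r(x,y) = g ((Real.cosh r) • x + (Real.sinh r) • B x) ((Real.cosh r) • y + (Real.sinh r) • B y). Then for all x y : V, Tendsto (fun r => 2 * Real.exp (−2*r) * I_r(x,y)) atTop (𝓝 ((1/2) * (g x y + 2 * g (B x) y + g (B x) (B y)))). In other words, 2 e^{−2r} I_r converges as r → ∞ to I* = (1/2)(I + 2·II + III), where I(x,y) = g x y, II(x,y) = g (B x) y and III(x,y) = g (B x) (B y). -/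
open Filter

/-- The first fundamental form at infinity as a limit of equidistant first
fundamental forms: `2 e^{−2r} I_r → I* = ½(I + 2·II + III)` as `r → ∞`. -/
theorem first_fundamental_form_at_infinity
    (V : Type*) [AddCommGroup V] [Module ℝ V]
    (g : V →ₗ[ℝ] V →ₗ[ℝ] ℝ) (B : V →ₗ[ℝ] V)
    (hB : ∀ x y : V, g (B x) y = g x (B y)) (x y : V) :
    Tendsto
      (fun r : ℝ => 2 * Real.exp (-2 * r) *
        g ((Real.cosh r) • x + (Real.sinh r) • B x)
          ((Real.cosh r) • y + (Real.sinh r) • B y))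
      atTop
      (nhds ((1/2) * (g x y + 2 * g (B x) y + g (B x) (B y)))) := by
  have he : Tendsto (fun r : ℝ => Real.exp (-2 * r)) atTop (nhds 0) :=
    Real.tendsto_exp_atBot.comp (tendsto_id.const_mul_atTop_of_neg (by norm_num))
  have hcont : Continuous fun e : ℝ => (1/2) * ((1 + e) ^ 2 * g x y +
      (1 + e) * (1 - e) * (2 * g (B x) y) + (1 - e) ^ 2 * g (B x) (B y)) := by
    fun_prop
  have hlim := (hcont.tendsto 0).comp he
  simp only [add_zero, sub_zero, one_pow, one_mul] at hlim
  refine hlim.congr fun r => ?_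
  have hsq : Real.exp (-2 * r) = Real.exp (-r) ^ 2 := by
    rw [← Real.exp_nat_mul]
    congr 1
    push_cast
    ring
  have hmul : Real.exp r * Real.exp (-r) = 1 := by
    rw [← Real.exp_add, add_neg_cancel, Real.exp_zero]
  have hcosh : Real.exp (-r) * Real.cosh r = (1 + Real.exp (-2 * r)) / 2 := by
    rw [Real.cosh_eq, hsq]
    linear_combination hmul / 2
  have hsinh : Real.exp (-r) * Real.sinh r = (1 - Real.exp (-2 * r)) / 2 := by
    rw [Real.sinh_eq, hsq]
    linear_combination hmul / 2
  have hcosh' : 1 + Real.exp (-2 * r) = 2 * (Real.exp (-r) * Real.cosh r) := by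
    rw [hcosh]
    ring
  have hsinh' : 1 - Real.exp (-2 * r) = 2 * (Real.exp (-r) * Real.sinh r) := by
    rw [hsinh]
    ring
  simp only [Function.comp_apply, hcosh', hsinh', map_add, map_smul, LinearMap.add_apply,
    LinearMap.smul_apply, smul_eq_mul, ← hB x y]
  rw [hsq]
  ring
end
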